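/- Let G'⁺ ⊂ ℝ⁴ be the set of points (x, y, z, t) with x² + y² < z², z² + t² < 1, and z > 0. Then the mean value over G'⁺ of arccos( t / √(z² + t²) ) + arcsin( √( (x² + y²) / (z² + t²) ) ) equals π/2 + 2/π, and the mean value over G'⁺ of arccos( t / √(z² + t²) ) − arcsin( √( (x² + y²) / (z² + t²) ) ) equals π/2 − 2/π. (Mean value means Lebesgue integral over G'⁺ divided by the measure of G'⁺.) -/

import Mathlib

open MeasureTheory

open Real Set in
/-- Polar coordinates for a function whose expression in polar coordinates separates. -/
lemma integral_eq_mul_of_polar_separated {f : ℝ × ℝ → ℝ} {a b : ℝ → ℝ}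
    (h : ∀ r θ, 0 < r → θ ∈ Ioo (-π) π → r * f (r * cos θ, r * sin θ) = a r * b θ) :
    ∫ p, f p = (∫ r in Ioi 0, a r) * ∫ θ in Ioo (-π) π, b θ := by
  rw [← integral_comp_polarCoord_symm, ← setIntegral_prod_mul, ← Measure.volume_eq_prod]
  exact setIntegral_congr_fun polarCoord.open_target.measurableSet
    fun p hp => h p.1 p.2 hp.1 hp.2

open Real Set in
lemma setIntegral_Ioi_indicator_Iio (g : ℝ → ℝ) {z : ℝ} (hz : 0 ≤ z) :
    ∫ r in Ioi 0, (Iio z).indicator g r = ∫ r in 0..z, g r := by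
  rw [setIntegral_indicator measurableSet_Iio, Ioi_inter_Iio, intervalIntegral.integral_of_le hz,
    integral_Ioc_eq_integral_Ioo]

open Real Set in
/-- Integral of a radial function over a disc. -/
lemma setIntegral_disc_radial (f : ℝ → ℝ) {z : ℝ} (hz : 0 ≤ z) :
    ∫ u in {u : ℝ × ℝ | u.1 ^ 2 + u.2 ^ 2 < z ^ 2}, f √(u.1 ^ 2 + u.2 ^ 2) =
      2 * π * ∫ ρ in 0..z, ρ * f ρ := by
  rw [← integral_indicator (measurableSet_lt (by fun_prop) (by fun_prop)),
    integral_eq_mul_of_polar_separated (a := (Iio z).indicator fun ρ => ρ * f ρ) (b := fun _ => 1),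
    setIntegral_Ioi_indicator_Iio _ hz]
  · simp [pi_pos.le, ← two_mul, mul_comm]
  · intro r θ hr _
    have h : (r * cos θ) ^ 2 + (r * sin θ) ^ 2 = r ^ 2 := by
      linear_combination r ^ 2 * sin_sq_add_cos_sq θ
    simp only [indicator_apply, mem_ofPred_eq, mem_Iio, h, sqrt_sq hr.le,
      pow_lt_pow_iff_left₀ hr.le hz two_ne_zero]
    split_ifs <;> simp

/-- The half of the open unit disc on which the first coordinate is positive. -/
def rightHalfDisc : Set (ℝ × ℝ) := {v | v.1 ^ 2 + v.2 ^ 2 < 1 ∧ 0 < v.1}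

lemma measurableSet_rightHalfDisc : MeasurableSet rightHalfDisc := by
  rw [rightHalfDisc, Set.ofPred_and]
  exact (measurableSet_lt (by fun_prop) (by fun_prop)).inter
    (measurableSet_lt (by fun_prop) (by fun_prop))

open Real Set in
/-- Integral over the half disc of a function homogeneous of degree two. -/
lemma setIntegral_rightHalfDisc {g : ℝ × ℝ → ℝ} {k : ℝ → ℝ}
    (h : ∀ r θ, 0 < r → θ ∈ Ioo (-(π / 2)) (π / 2) →
      g (r * cos θ, r * sin θ) = r ^ 2 * k θ) :
    ∫ v in rightHalfDisc, g v = 1 / 4 * ∫ θ in -(π / 2)..π / 2, k θ := by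
  have hπ := pi_pos
  rw [← integral_indicator measurableSet_rightHalfDisc,
    integral_eq_mul_of_polar_separated (a := (Iio 1).indicator fun r => r ^ 3)
      (b := (Ioo (-(π / 2)) (π / 2)).indicator k),
    setIntegral_Ioi_indicator_Iio _ zero_le_one, setIntegral_indicator measurableSet_Ioo,
    inter_eq_right.2 (Ioo_subset_Ioo (by linarith) (by linarith)),
    integral_pow, intervalIntegral.integral_of_le (by linarith), integral_Ioc_eq_integral_Ioo]
  · norm_num
  · intro r θ hr hθ
    have hn : (r * cos θ) ^ 2 + (r * sin θ) ^ 2 = r ^ 2 := by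
      linear_combination r ^ 2 * sin_sq_add_cos_sq θ
    have hcos : 0 < r * cos θ ↔ θ ∈ Ioo (-(π / 2)) (π / 2) := by
      refine ⟨fun hc => ?_, fun hc => mul_pos hr (cos_pos_of_mem_Ioo hc)⟩
      have hc : 0 < cos θ := pos_of_mul_pos_right hc hr.le
      by_contra hn
      rw [mem_Ioo, not_and_or, not_lt, not_lt] at hn
      rcases hn with hn | hn
      · rw [← cos_neg] at hc
        exact hc.not_ge (cos_nonpos_of_pi_div_two_le_of_le (by linarith) (by linarith [hθ.1]))
      · exact hc.not_ge (cos_nonpos_of_pi_div_two_le_of_le hn (by linarith [hθ.2]))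
    have hr1 : r ^ 2 < 1 ↔ r < 1 := by
      simpa using pow_lt_pow_iff_left₀ hr.le zero_le_one two_ne_zero
    simp only [indicator_apply, rightHalfDisc, mem_ofPred_eq, mem_Iio, hn, hcos, hr1]
    by_cases h1 : r < 1 <;> by_cases h2 : θ ∈ Ioo (-(π / 2)) (π / 2)
    · simp only [h1, h2, and_self, if_true, h r θ hr h2]
      ring
    all_goals simp [h1, h2]

/-- The part of the solid cone `x² + y² < z²` lying over the half disc in `(z, t)`. -/
def coneRegion : Set (ℝ × ℝ × ℝ × ℝ) :=
  {p | p.1 ^ 2 + p.2.1 ^ 2 < p.2.2.1 ^ 2 ∧ p.2.2.1 ^ 2 + p.2.2.2 ^ 2 < 1 ∧ 0 < p.2.2.1}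

lemma measurableSet_coneRegion : MeasurableSet coneRegion := by
  rw [coneRegion, Set.ofPred_and, Set.ofPred_and]
  exact (measurableSet_lt (by fun_prop) (by fun_prop)).inter
    ((measurableSet_lt (by fun_prop) (by fun_prop)).inter
      (measurableSet_lt (by fun_prop) (by fun_prop)))

lemma volume_coneRegion_lt_top : volume coneRegion < ⊤ := by
  refine (measure_mono (t := Set.Icc (-1) 1 ×ˢ Set.Icc (-1) 1 ×ˢ Set.Icc (-1) 1 ×ˢ
    Set.Icc (-1) 1) ?_).trans_lt (IsCompact.measure_lt_top ?_)
  · rintro ⟨x, y, z, t⟩ ⟨h1, h2, -⟩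
    simp only [Set.mem_prod, Set.mem_Icc, ← abs_le, ← sq_le_one_iff_abs_le_one] at *
    refine ⟨?_, ?_, ?_, ?_⟩ <;> nlinarith [sq_nonneg x, sq_nonneg y, sq_nonneg z, sq_nonneg t]
  · exact isCompact_Icc.prod (isCompact_Icc.prod (isCompact_Icc.prod isCompact_Icc))

lemma integrableOn_coneRegion_of_bounded {F : ℝ × ℝ × ℝ × ℝ → ℝ} {C : ℝ} (hF : Measurable F)
    (hC : ∀ p, |F p| ≤ C) : IntegrableOn F coneRegion :=
  Measure.integrableOn_of_bounded volume_coneRegion_lt_top.ne hF.aestronglyMeasurable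
    (ae_of_all _ hC)

open Real Set in
lemma setIntegral_coneRegion {f : ℝ → ℝ × ℝ → ℝ}
    (hf : IntegrableOn (fun p : ℝ × ℝ × ℝ × ℝ => f √(p.1 ^ 2 + p.2.1 ^ 2) p.2.2) coneRegion) :
    ∫ p in coneRegion, f √(p.1 ^ 2 + p.2.1 ^ 2) p.2.2 =
      ∫ v in rightHalfDisc, 2 * π * ∫ ρ in 0..v.1, ρ * f ρ v := by
  have hmp := volume_preserving_prodAssoc (α₁ := ℝ) (β₁ := ℝ) (γ₁ := ℝ × ℝ)
  have he := MeasurableEquiv.measurableEmbedding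
    (MeasurableEquiv.prodAssoc : (ℝ × ℝ) × ℝ × ℝ ≃ᵐ ℝ × ℝ × ℝ × ℝ)
  rw [← integrable_indicator_iff measurableSet_coneRegion, ← hmp.integrable_comp_emb he,
    Measure.volume_eq_prod] at hf
  rw [← integral_indicator measurableSet_coneRegion, ← hmp.integral_comp he,
    Measure.volume_eq_prod (ℝ × ℝ) (ℝ × ℝ)]
  refine (integral_prod_symm _ hf).trans ?_
  rw [← integral_indicator measurableSet_rightHalfDisc]
  congr 1 with v
  by_cases hv : v ∈ rightHalfDisc
  · rw [indicator_of_mem hv, ← setIntegral_disc_radial (fun ρ => f ρ v) hv.2.le,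
      ← integral_indicator (measurableSet_lt (by fun_prop) (by fun_prop))]
    congr 1 with u
    obtain ⟨h1, h2⟩ := hv
    simp [indicator_apply, coneRegion, h1, h2, MeasurableEquiv.prodAssoc]
  · rw [indicator_of_notMem hv]
    refine integral_eq_zero_of_ae (ae_of_all _ fun u => indicator_of_notMem ?_ _)
    exact fun hu => hv hu.2

open Real Set in
lemma volume_real_coneRegion : (volume coneRegion).toReal = π ^ 2 / 8 := by
  have h1 : (volume coneRegion).toReal = ∫ _ in coneRegion, (1 : ℝ) := by
    simp [measureReal_def]
  rw [h1, setIntegral_coneRegion (f := fun _ _ => 1)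
      (integrableOn_coneRegion_of_bounded measurable_const fun _ => le_rfl),
    setIntegral_rightHalfDisc (k := fun θ => π * cos θ ^ 2)]
  · simp
    ring
  · intro r θ _ _
    simp
    ring

open Real Set in
lemma integral_mul_arcsin {s : ℝ} (h0 : 0 ≤ s) (h1 : s ≤ 1) :
    ∫ w in 0..s, w * arcsin w = (s ^ 2 / 2 - 1 / 4) * arcsin s + s * √(1 - s ^ 2) / 4 := by
  rw [intervalIntegral.integral_eq_sub_of_hasDerivAt_of_le
    (f := fun s => (s ^ 2 / 2 - 1 / 4) * arcsin s + s * √(1 - s ^ 2) / 4) h0]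
  · simp
  · fun_prop
  · intro w hw
    have hpos : 0 < 1 - w ^ 2 := by nlinarith [hw.1, hw.2]
    have hd := ((((hasDerivAt_id w).pow 2).div_const 2).sub_const (1 / 4)).mul
      (hasDerivAt_arcsin (by linarith [hw.1]) (by linarith [hw.2]))
    have hd' := ((hasDerivAt_id w).mul
      ((((hasDerivAt_id w).pow 2).const_sub 1).sqrt hpos.ne')).div_const 4
    convert! hd.add hd' using 1
    have hs : √(1 - w ^ 2) ≠ 0 := (sqrt_pos.2 hpos).ne'
    have hs2 := sq_sqrt hpos.le
    simp only [id, Pi.pow_apply]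
    field_simp
    rw [hs2]
    ring
  · exact (by fun_prop : Continuous fun w => w * arcsin w).intervalIntegrable _ _

open Real Set in
lemma integral_polar_mul_arcsin {r s : ℝ} (hr : 0 < r) (h0 : 0 ≤ s) (h1 : s ≤ 1) :
    ∫ ρ in 0..r * s, ρ * arcsin (ρ / r) =
      r ^ 2 * ((s ^ 2 / 2 - 1 / 4) * arcsin s + s * √(1 - s ^ 2) / 4) := by
  have h := intervalIntegral.integral_comp_div (a := 0) (b := r * s)
    (fun w => r * (w * arcsin w)) hr.ne'
  rw [zero_div, mul_div_cancel_left₀ _ hr.ne',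
    intervalIntegral.integral_const_mul r fun w => w * arcsin w, integral_mul_arcsin h0 h1] at h
  rw [pow_two, mul_assoc r r]
  refine Eq.trans ?_ h
  congr 1 with ρ
  field_simp

open Real Set in
lemma integral_arcsin_cos_profile :
    ∫ θ in -(π / 2)..π / 2,
      ((cos θ ^ 2 / 2 - 1 / 4) * arcsin (cos θ) + cos θ * √(1 - cos θ ^ 2) / 4) = 1 / 2 := by
  set K : ℝ → ℝ := fun θ =>
    (cos θ ^ 2 / 2 - 1 / 4) * arcsin (cos θ) + cos θ * √(1 - cos θ ^ 2) / 4 with hK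
  have hπ := pi_pos
  have hc : Continuous K := by fun_prop
  have hpos : ∫ θ in 0..π / 2, K θ = 1 / 4 := by
    rw [intervalIntegral.integral_eq_sub_of_hasDerivAt_of_le
      (f := fun θ => (π / 2 - θ) * sin (2 * θ) / 8 - cos (2 * θ) / 8) (by positivity)]
    · simp [mul_div_cancel₀]
      norm_num
    · fun_prop
    · intro θ hθ
      have h2 : HasDerivAt (fun θ : ℝ => 2 * θ) 2 θ := by
        simpa using (hasDerivAt_id θ).const_mul 2
      have hd := ((((hasDerivAt_id θ).const_sub (π / 2)).mul h2.sin).div_const 8).sub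
        (h2.cos.div_const 8)
      convert! hd using 1
      have ha : arcsin (cos θ) = π / 2 - θ := by
        rw [← sin_pi_div_two_sub]
        exact arcsin_sin (by linarith [hθ.2]) (by linarith [hθ.1])
      simp only [hK, id, ha,
        ← sin_eq_sqrt_one_sub_cos_sq hθ.1.le (by linarith [hθ.2] : θ ≤ π), sin_two_mul,
        cos_two_mul]
      ring
    · exact hc.intervalIntegrable _ _
  have hneg : ∫ θ in -(π / 2)..0, K θ = 1 / 4 := by
    rw [← hpos, ← neg_zero, ← intervalIntegral.integral_comp_neg, neg_zero]
    simp [hK]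
  rw [← intervalIntegral.integral_add_adjacent_intervals (hc.intervalIntegrable _ 0)
    (hc.intervalIntegrable 0 _), hpos, hneg]
  norm_num

open Real Set in
lemma setIntegral_coneRegion_arcsin :
    IntegrableOn (fun p : ℝ × ℝ × ℝ × ℝ =>
      arcsin √((p.1 ^ 2 + p.2.1 ^ 2) / (p.2.2.1 ^ 2 + p.2.2.2 ^ 2))) coneRegion ∧
    ∫ p in coneRegion, arcsin √((p.1 ^ 2 + p.2.1 ^ 2) / (p.2.2.1 ^ 2 + p.2.2.2 ^ 2)) =
      π / 4 := by
  have hint : IntegrableOn (fun p : ℝ × ℝ × ℝ × ℝ =>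
      arcsin √((p.1 ^ 2 + p.2.1 ^ 2) / (p.2.2.1 ^ 2 + p.2.2.2 ^ 2))) coneRegion :=
    integrableOn_coneRegion_of_bounded (C := π / 2) (by fun_prop) fun p =>
      abs_le.2 ⟨neg_pi_div_two_le_arcsin _, arcsin_le_pi_div_two _⟩
  refine ⟨hint, ?_⟩
  have hsqrt : ∀ p : ℝ × ℝ × ℝ × ℝ, √((p.1 ^ 2 + p.2.1 ^ 2) / (p.2.2.1 ^ 2 + p.2.2.2 ^ 2)) =
      √(p.1 ^ 2 + p.2.1 ^ 2) / √(p.2.2.1 ^ 2 + p.2.2.2 ^ 2) :=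
    fun p => sqrt_div (by positivity) _
  simp only [hsqrt] at hint ⊢
  rw [setIntegral_coneRegion (f := fun ρ v => arcsin (ρ / √(v.1 ^ 2 + v.2 ^ 2))) hint,
    setIntegral_rightHalfDisc (k := fun θ => 2 * π *
      ((cos θ ^ 2 / 2 - 1 / 4) * arcsin (cos θ) + cos θ * √(1 - cos θ ^ 2) / 4)),
    intervalIntegral.integral_const_mul, integral_arcsin_cos_profile]
  · ring
  · intro r θ hr hθ
    have hn : (r * cos θ) ^ 2 + (r * sin θ) ^ 2 = r ^ 2 := by
      linear_combination r ^ 2 * sin_sq_add_cos_sq θ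
    simp only [hn, sqrt_sq hr.le]
    rw [integral_polar_mul_arcsin hr (cos_pos_of_mem_Ioo hθ).le (cos_le_one θ)]
    ring

open Real Set in
/-- The reflection `t ↦ -t` preserves the region, so `arccos (t / √(z² + t²))` averages to
`π / 2`. -/
lemma setIntegral_coneRegion_arccos :
    IntegrableOn (fun p : ℝ × ℝ × ℝ × ℝ =>
      arccos (p.2.2.2 / √(p.2.2.1 ^ 2 + p.2.2.2 ^ 2))) coneRegion ∧
    ∫ p in coneRegion, arccos (p.2.2.2 / √(p.2.2.1 ^ 2 + p.2.2.2 ^ 2)) =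
      π / 2 * (volume coneRegion).toReal := by
  have hint : IntegrableOn (fun p : ℝ × ℝ × ℝ × ℝ =>
      arccos (p.2.2.2 / √(p.2.2.1 ^ 2 + p.2.2.2 ^ 2))) coneRegion :=
    integrableOn_coneRegion_of_bounded (C := π)
      (measurable_arccos.comp (by fun_prop)) fun p =>
      abs_le.2 ⟨by linarith [arccos_nonneg (p.2.2.2 / √(p.2.2.1 ^ 2 + p.2.2.2 ^ 2)), pi_pos],
        arccos_le_pi _⟩
  refine ⟨hint, ?_⟩
  let e : ℝ × ℝ × ℝ × ℝ ≃ᵐ ℝ × ℝ × ℝ × ℝ :=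
    (MeasurableEquiv.refl ℝ).prodCongr ((MeasurableEquiv.refl ℝ).prodCongr
      ((MeasurableEquiv.refl ℝ).prodCongr (MeasurableEquiv.neg ℝ)))
  have he : MeasurePreserving e volume volume :=
    (MeasurePreserving.id volume).prod ((MeasurePreserving.id volume).prod
      ((MeasurePreserving.id volume).prod (Measure.measurePreserving_neg volume)))
  have hpre : e ⁻¹' coneRegion = coneRegion := by
    ext p
    simp [e, coneRegion, MeasurableEquiv.prodCongr]
  have hrefl := he.setIntegral_preimage_emb e.measurableEmbedding
    (fun p => arccos (p.2.2.2 / √(p.2.2.1 ^ 2 + p.2.2.2 ^ 2))) coneRegion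
  rw [hpre] at hrefl
  have hsub : ∀ p, arccos ((e p).2.2.2 / √((e p).2.2.1 ^ 2 + (e p).2.2.2 ^ 2)) =
      π - arccos (p.2.2.2 / √(p.2.2.1 ^ 2 + p.2.2.2 ^ 2)) := by
    intro p
    simp [e, MeasurableEquiv.prodCongr, neg_div, arccos_neg]
  simp only [hsub] at hrefl
  rw [integral_sub (integrable_const_iff.2 <| .inr <|
      isFiniteMeasure_restrict.2 volume_coneRegion_lt_top.ne) hint, setIntegral_const,
    smul_eq_mul, measureReal_def] at hrefl
  linarith

/-- Over the region `G'⁺ = {(x,y,z,t) : x² + y² < z², z² + t² < 1, z > 0}` in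
`ℝ⁴`, the mean value of `arccos(t/√(z²+t²)) + arcsin √((x²+y²)/(z²+t²))` equals
`π/2 + 2/π`, and the mean value of `arccos(t/√(z²+t²)) − arcsin √((x²+y²)/(z²+t²))`
equals `π/2 − 2/π`. -/
theorem stmt_12
    (Gp : Set (ℝ × ℝ × ℝ × ℝ))
    (hGp : Gp = {p : ℝ × ℝ × ℝ × ℝ |
        p.1 ^ 2 + p.2.1 ^ 2 < p.2.2.1 ^ 2 ∧ p.2.2.1 ^ 2 + p.2.2.2 ^ 2 < 1 ∧
        0 < p.2.2.1}) :
    (∫ p in Gp, (Real.arccos (p.2.2.2 / Real.sqrt (p.2.2.1 ^ 2 + p.2.2.2 ^ 2)) +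
        Real.arcsin (Real.sqrt
          ((p.1 ^ 2 + p.2.1 ^ 2) / (p.2.2.1 ^ 2 + p.2.2.2 ^ 2)))) ∂volume) /
      (volume Gp).toReal = Real.pi / 2 + 2 / Real.pi ∧
    (∫ p in Gp, (Real.arccos (p.2.2.2 / Real.sqrt (p.2.2.1 ^ 2 + p.2.2.2 ^ 2)) -
        Real.arcsin (Real.sqrt
          ((p.1 ^ 2 + p.2.1 ^ 2) / (p.2.2.1 ^ 2 + p.2.2.2 ^ 2)))) ∂volume) /
      (volume Gp).toReal = Real.pi / 2 - 2 / Real.pi := by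
  have hπ := Real.pi_ne_zero
  obtain ⟨hi, hI⟩ := setIntegral_coneRegion_arccos
  obtain ⟨hj, hJ⟩ := setIntegral_coneRegion_arcsin
  change Gp = coneRegion at hGp
  subst hGp
  rw [integral_add hi hj, integral_sub hi hj, hI, hJ, volume_real_coneRegion]
  constructor <;> field_simp <;> ring
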